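/- Fix D ≥ 1, k ∈ ℝ, a dimension m ≥ 1 and a vector v ∈ ℝ^m, and define f : ℝ^D → ℝ^D by f(x) = D^{k/2}·x/‖x‖ for x ≠ 0 (Euclidean norm). Define F on pairs (W, b), with W an D×m real matrix and b ∈ ℝ^D, by F(W, b) = f(W·v + b). Let α > 0 and suppose W·v + b ≠ 0. Then F(α·W, α·b) = F(W, b), and the Fréchet derivative of F at (α·W, α·b) equals (1/α) times the Fréchet derivative of F at (W, b). -/

import Mathlib

/-- The Fréchet derivative of a map invariant under scaling by `c ≠ 0` scales by `c⁻¹`. -/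
theorem fderiv_smul_eq_inv_smul_of_comp_smul_eq {E G : Type*} [NormedAddCommGroup E]
    [NormedSpace ℝ E] [NormedAddCommGroup G] [NormedSpace ℝ G] {g : E → G} {c : ℝ}
    (hc : c ≠ 0) (hg : ∀ x, g (c • x) = g x) (x : E) :
    fderiv ℝ g (c • x) = c⁻¹ • fderiv ℝ g x := by
  have h := fderiv_comp_smul (𝕜 := ℝ) (f := g) (x := x) c
  rw [funext hg] at h
  rw [h, smul_smul, inv_mul_cancel₀ hc, one_smul]


/-- Multiplying the affine parameters `(W, b)` by a positive scalar `α` leaves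
the UnitNorm output `F(W, b) = f(Wv + b)` unchanged, while scaling its gradient
with respect to the parameters by `1/α`. -/
theorem unitNorm_affine_param_scale
    (D : ℕ) (hD : 1 ≤ D) (k : ℝ) (m : ℕ) (hm : 1 ≤ m) (v : Fin m → ℝ)
    (f : EuclideanSpace ℝ (Fin D) → EuclideanSpace ℝ (Fin D))
    (hf : ∀ x, f x = ((D : ℝ) ^ (k / 2) * ‖x‖⁻¹) • x)
    (F : (Fin D → Fin m → ℝ) × EuclideanSpace ℝ (Fin D) → EuclideanSpace ℝ (Fin D))
    (hF : ∀ W b, F (W, b)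
      = f ((WithLp.equiv 2 (Fin D → ℝ)).symm (fun i => ∑ j, W i j * v j) + b))
    (α : ℝ) (hα : 0 < α)
    (W : Fin D → Fin m → ℝ) (b : EuclideanSpace ℝ (Fin D))
    (hWvb : (WithLp.equiv 2 (Fin D → ℝ)).symm (fun i => ∑ j, W i j * v j) + b ≠ 0) :
    F (α • W, α • b) = F (W, b) ∧
      fderiv ℝ F (α • W, α • b) = α⁻¹ • fderiv ℝ F (W, b) := by
  have hscale : ∀ x, f (α • x) = f x := fun x => by
    rw [hf, hf, norm_smul, Real.norm_of_nonneg hα.le, smul_smul]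
    congr 1
    field_simp
  have hinv : ∀ p, F (α • p) = F p := by
    rintro ⟨A, c⟩
    rw [Prod.smul_mk, hF, hF, ← hscale (_ + c)]
    congr 1
    ext i
    simp [Finset.mul_sum, mul_assoc]
  exact ⟨hinv (W, b), fderiv_smul_eq_inv_smul_of_comp_smul_eq hα.ne' hinv (W, b)⟩
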